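/- arXiv:2303.13695 — 2 statements merged into one kernel-verified Lean document; each statement's English description precedes it below -/
import Mathlib

section
/- For n ≥ 4, let w ∈ S_n be the permutation with w(1) = n−1, w(2) = n, w(n−1) = 1, w(n) = 2, and w(i) = n − i + 1 for 3 ≤ i ≤ n−2. Let J = {2, 3, ..., n−2} (simple reflections s_2, ..., s_{n−2}). Then the sizes of the ranks of the lower interval [e, w^J] ∩ W^J in Bruhat order, from rank 0 to rank 2n−5, are 1, 2, 3, ..., n−4, n−3, n−2, n−1, n−3, n−4, ..., 2, 1. -/
open Equiv

/-- The Coxeter length of a permutation: its number of inversions. -/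
def permLen {n : ℕ} (w : Perm (Fin n)) : ℕ :=
  (Finset.univ.filter fun p : Fin n × Fin n => p.1 < p.2 ∧ w p.2 < w p.1).card

/-- Bruhat order on `S_n`: the reflexive-transitive closure of
`u < u·t` for transpositions `t` increasing the length. -/
def BruhatLE {n : ℕ} (u v : Perm (Fin n)) : Prop :=
  Relation.ReflTransGen
    (fun x y => permLen x < permLen y ∧ ∃ i j : Fin n, y = x * Equiv.swap i j) u v

/-- For `J = {2, 3, …, n-2}` (1-indexed simple reflections), `W^J` is the set of
minimal length left coset representatives: permutations that are increasing on
positions `2, …, n-1` (1-indexed). Positions here are 0-indexed. -/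
def WJmin (n : ℕ) : Set (Perm (Fin n)) :=
  {u | ∀ i j : Fin n, 1 ≤ i.val → i < j → j.val ≤ n - 2 → u i < u j}

/-- `W_J` for `J = {2, …, n-2}`: permutations fixing positions `1` and `n`
(0-indexed: `0` and `n-1`). -/
def WJsub (n : ℕ) (hn : 1 ≤ n) : Set (Perm (Fin n)) :=
  {u | u ⟨0, by omega⟩ = ⟨0, by omega⟩ ∧ u ⟨n - 1, by omega⟩ = ⟨n - 1, by omega⟩}

/-- Multiplying on the right by a transposition that creates an inversion increases the length. -/
theorem permLen_lt_mul_swap {n : ℕ} (x : Perm (Fin n)) {i j : Fin n} (hij : i < j)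
    (hx : x i < x j) : permLen x < permLen (x * swap i j) := by
  unfold permLen
  let f : Fin n × Fin n → Fin n × Fin n := fun p =>
    if swap i j p.1 < swap i j p.2 then (swap i j p.1, swap i j p.2) else p
  rw [← Finset.card_image_of_injOn (f := f)]
  · apply Finset.card_lt_card
    rw [Finset.ssubset_iff_of_subset]
    · refine ⟨(i, j), Finset.mem_filter.2 ⟨Finset.mem_univ _, hij, by simpa using hx⟩, ?_⟩
      simp only [Finset.mem_image, Finset.mem_filter, Finset.mem_univ, true_and, Prod.exists,
        not_exists, not_and, and_imp, f]
      intro p q hpq hinv h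
      split_ifs at h with hc
      · simp only [Prod.mk.injEq] at h
        have h1 : p = j := by rw [← swap_apply_self i j p, h.1, swap_apply_left]
        have h2 : q = i := by rw [← swap_apply_self i j q, h.2, swap_apply_right]
        subst h1 h2
        exact absurd hpq hij.asymm
      · simp only [Prod.mk.injEq] at h
        rw [h.1, h.2] at hinv
        exact absurd hinv hx.asymm
    · intro r hr
      simp only [Finset.mem_image, Finset.mem_filter, Finset.mem_univ, true_and, Prod.exists,
        f] at hr
      obtain ⟨p, q, ⟨hpq, hinv⟩, rfl⟩ := hr
      refine Finset.mem_filter.2 ⟨Finset.mem_univ _, ?_⟩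
      simp only [Perm.mul_apply]
      split_ifs with hc
      · simpa using ⟨hc, hinv⟩
      · refine ⟨hpq, ?_⟩
        simp only [swap_apply_def] at hc ⊢
        grind
  · rintro ⟨p, q⟩ hp ⟨p', q'⟩ hp' h
    simp only [Finset.coe_filter, Finset.mem_univ, true_and, Set.mem_ofPred_eq] at hp hp'
    simp only [f] at h
    split_ifs at h with h1 h2 h2
    · simpa using h
    · simp only [Prod.mk.injEq] at h
      rw [← h.1, ← h.2, swap_apply_self, swap_apply_self] at h2
      exact absurd hp.1 h2
    · simp only [Prod.mk.injEq] at h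
      rw [h.1, h.2, swap_apply_self, swap_apply_self] at h1
      exact absurd hp'.1 h1
    · exact h

theorem lt_of_permLen_lt_mul_swap {n : ℕ} {x : Perm (Fin n)} {i j : Fin n} (hij : i < j)
    (h : permLen x < permLen (x * swap i j)) : x i < x j := by
  by_contra hx
  have hne : x i ≠ x j := fun h' => hij.ne (x.injective h')
  have := permLen_lt_mul_swap (x * swap i j) hij
    (by simpa using lt_of_le_of_ne (not_lt.1 hx) hne.symm)
  rw [mul_assoc, swap_mul_self, mul_one] at this
  exact absurd h this.asymm

/-- The value at the first position is monotone, and the value at the last position antitone,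
for the Bruhat order. -/
theorem BruhatLE.first_le_and_last_le {n : ℕ} {u v : Perm (Fin n)} (h : BruhatLE u v)
    {f l : Fin n} (hf : ∀ i, f ≤ i) (hl : ∀ i, i ≤ l) : u f ≤ v f ∧ v l ≤ u l := by
  induction h with
  | refl => exact ⟨le_rfl, le_rfl⟩
  | @tail x y _ hxy ih =>
    obtain ⟨hlen, i, j, rfl⟩ := hxy
    suffices ∀ i j : Fin n, i < j → permLen x < permLen (x * swap i j) →
        x f ≤ (x * swap i j) f ∧ (x * swap i j) l ≤ x l by
      have key : x f ≤ (x * swap i j) f ∧ (x * swap i j) l ≤ x l := by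
        rcases lt_trichotomy i j with h | h | h
        · exact this i j h hlen
        · subst h; simp
        · rw [swap_comm] at hlen ⊢; exact this j i h hlen
      exact ⟨ih.1.trans key.1, key.2.trans ih.2⟩
    intro i j hij hlen
    have hx := lt_of_permLen_lt_mul_swap hij hlen
    have := hf i
    have := hl j
    simp only [Perm.mul_apply, swap_apply_def]
    constructor <;> split_ifs <;> grind

/-- An element of `W^J` is determined by its first and last values. -/
theorem WJmin_ext {n : ℕ} {u v : Perm (Fin n)} (hu : u ∈ WJmin n) (hv : v ∈ WJmin n)
    {f l : Fin n} (hf : f.val = 0) (hl : l.val = n - 1) (h0 : u f = v f) (h1 : u l = v l) :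
    u = v := by
  suffices ∀ m : ℕ, ∀ i : Fin n, i.val = m → u i = v i from Equiv.ext fun i => this _ i rfl
  intro m
  induction m using Nat.strong_induction_on with
  | _ m ih =>
    intro i him
    by_cases hif : i = f
    · rw [hif, h0]
    by_cases hil : i = l
    · rw [hil, h1]
    have key : ∀ u v : Perm (Fin n), v ∈ WJmin n → u f = v f → u l = v l →
        (∀ j : Fin n, j < i → u j = v j) → ¬ u i < v i := by
      intro u v hv h0 h1 hlow hlt
      obtain ⟨j, hj⟩ := v.surjective (u i)
      have hjf : j ≠ f := by
        rintro rfl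
        exact hif (u.injective (by rw [← hj, h0]))
      have hjl : j ≠ l := by
        rintro rfl
        exact hil (u.injective (by rw [← hj, h1]))
      rcases lt_trichotomy j i with h | h | h
      · exact h.ne (u.injective ((hlow j h).trans hj))
      · subst h; exact hlt.ne hj.symm
      · have := hv i j (by grind) h (by grind)
        rw [hj] at this
        exact absurd hlt this.asymm
    have hlow : ∀ j : Fin n, j < i → u j = v j := fun j hj => ih j.val (by grind) j rfl
    exact le_antisymm (not_lt.1 (key v u hu h0.symm h1.symm fun j hj => (hlow j hj).symm))
      (not_lt.1 (key u v hv h0 h1 hlow))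

/-- Every pair of distinct values is realised at the two ends of an element of `W^J`. -/
theorem exists_mem_WJmin {n : ℕ} {f l p q : Fin n} (hf : f.val = 0) (hl : l.val = n - 1)
    (hfl : f ≠ l) (hpq : p ≠ q) : ∃ u ∈ WJmin n, u f = p ∧ u l = q := by
  have hpq' : p.val ≠ q.val := fun h => hpq (Fin.ext h)
  have hfl' : f.val ≠ l.val := fun h => hfl (Fin.ext h)
  have hp := p.isLt
  have hq := q.isLt
  let g : ℕ → ℕ := fun i => if i = 0 then p.val else if i = n - 1 then q.val else
    if i - 1 < min p.val q.val then i - 1 else if i < max p.val q.val then i else i + 1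
  have hg : ∀ i, i < n → g i < n := by
    intro i hi
    simp only [g]
    split_ifs <;> omega
  have hinj : ∀ i j, i < n → j < n → g i = g j → i = j := by
    intro i j hi hj h
    simp only [g] at h
    split_ifs at h <;> omega
  let F : Fin n → Fin n := fun i => ⟨g i.val, hg _ i.isLt⟩
  have hF : Function.Injective F := fun i j h =>
    Fin.ext (hinj _ _ i.isLt j.isLt (Fin.mk.inj_iff.1 h))
  refine ⟨Equiv.ofBijective F (Finite.injective_iff_bijective.1 hF), ?_, ?_, ?_⟩
  · intro i j hi hij hj
    simp only [ofBijective_apply, F, Fin.lt_def, g] at hij ⊢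
    split_ifs <;> omega
  · ext
    simp [F, g, hf]
  · ext
    have : n - 1 ≠ 0 := by omega
    simp [F, g, hl, this]

theorem permLen_of_mem_WJmin {n : ℕ} {u : Perm (Fin n)} (hu : u ∈ WJmin n) {f l : Fin n}
    (hf : f.val = 0) (hl : l.val = n - 1) (hfl : f ≠ l) :
    permLen u + (if u l < u f then 1 else 0) = (u f).val + (n - 1 - (u l).val) := by
  have hfl' : f.val ≠ l.val := fun h => hfl (Fin.ext h)
  let A : Finset (Fin n × Fin n) := (Finset.Iio (u f)).image fun y => (f, u.symm y)
  let B : Finset (Fin n × Fin n) := (Finset.Ioi (u l)).image fun y => (u.symm y, l)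
  have hA : A.card = (u f).val := by
    rw [Finset.card_image_of_injective _ fun a b h => by simpa using h, Fin.card_Iio]
  have hB : B.card = n - 1 - (u l).val := by
    rw [Finset.card_image_of_injective _ fun a b h => by simpa using h, Fin.card_Ioi]
  have memA : ∀ r, r ∈ A ↔ r.1 = f ∧ u r.2 < u f := by
    rintro ⟨r, s⟩
    simp only [A, Finset.mem_image, Finset.mem_Iio, Prod.mk.injEq]
    constructor
    · rintro ⟨y, hy, rfl, rfl⟩
      simpa using hy
    · rintro ⟨rfl, h⟩
      exact ⟨u s, h, rfl, by simp⟩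
  have memB : ∀ r, r ∈ B ↔ r.2 = l ∧ u l < u r.1 := by
    rintro ⟨r, s⟩
    simp only [B, Finset.mem_image, Finset.mem_Ioi, Prod.mk.injEq]
    constructor
    · rintro ⟨y, hy, rfl, rfl⟩
      simpa using hy
    · rintro ⟨rfl, h⟩
      exact ⟨u r, h, by simp, rfl⟩
  have hU : permLen u = (A ∪ B).card := by
    unfold permLen
    congr 1
    ext ⟨r, s⟩
    simp only [Finset.mem_filter, Finset.mem_univ, true_and, Finset.mem_union, memA, memB]
    constructor
    · rintro ⟨hrs, hinv⟩
      by_cases hr : r = f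
      · exact Or.inl ⟨hr, hr ▸ hinv⟩
      by_cases hs : s = l
      · exact Or.inr ⟨hs, hs ▸ hinv⟩
      exact absurd hinv (hu r s (by grind) hrs (by grind)).asymm
    · rintro (⟨rfl, h⟩ | ⟨rfl, h⟩)
      · have : s ≠ r := by rintro rfl; exact h.ne rfl
        exact ⟨by grind, h⟩
      · have : r ≠ s := by rintro rfl; exact h.ne rfl
        exact ⟨by grind, h⟩
  have hI : (A ∩ B).card = if u l < u f then 1 else 0 := by
    have : A ∩ B = if u l < u f then {(f, l)} else ∅ := by
      ext ⟨r, s⟩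
      rw [Finset.mem_inter, memA, memB]
      split_ifs with h <;> simp only [Finset.mem_singleton, Prod.mk.injEq, Finset.notMem_empty]
      · constructor
        · exact fun h => ⟨h.1.1, h.2.1⟩
        · rintro ⟨rfl, rfl⟩
          exact ⟨⟨rfl, h⟩, rfl, h⟩
      · simp only [iff_false]
        rintro ⟨⟨rfl, h1⟩, rfl, h2⟩
        exact h h1
    rw [this]
    split_ifs <;> simp
  rw [hU, ← hI, Finset.card_union_add_card_inter, hA, hB]

/-- Exchanging two values `v < v'`, at least one of them at an end position, with all values
strictly between them at end positions, keeps a permutation in `W^J`. -/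
theorem swap_mul_mem_WJmin {n : ℕ} {u : Perm (Fin n)} (hu : u ∈ WJmin n) {f l : Fin n}
    (hf : f.val = 0) (hl : l.val = n - 1) {v v' : Fin n} (hv : v < v')
    (hend : v = u f ∨ v' = u l)
    (hbtw : ∀ x, v < x → x < v' → x = u f ∨ x = u l) : swap v v' * u ∈ WJmin n := by
  intro i j hi hij hj
  have h := hu i j hi hij hj
  have hif : u i ≠ u f := fun h => by have := u.injective h; grind
  have hil : u i ≠ u l := fun h => by have := u.injective h; grind
  have hjf : u j ≠ u f := fun h => by have := u.injective h; grind
  have hjl : u j ≠ u l := fun h => by have := u.injective h; grind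
  have h1 := hbtw (u i)
  have h2 := hbtw (u j)
  simp only [Perm.mul_apply, swap_apply_def]
  split_ifs <;> grind

theorem bruhatLE_of_swap_mul {n : ℕ} {u a : Perm (Fin n)} {v v' : Fin n} (hv : v < v')
    (hpos : u.symm v < u.symm v') (h : BruhatLE (swap v v' * u) a) : BruhatLE u a := by
  have heq : swap v v' * u = u * swap (u.symm v) (u.symm v') := by
    rw [Equiv.mul_swap_eq_swap_mul]
    simp
  refine Relation.ReflTransGen.head ⟨?_, _, _, heq⟩ h
  rw [heq]
  exact permLen_lt_mul_swap u hpos (by simpa using hv)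

theorem bruhatLE_of_mem_WJmin {n : ℕ} (hn : 4 ≤ n) {a : Perm (Fin n)} (ha : a ∈ WJmin n)
    {f l : Fin n} (hf : f.val = 0) (hl : l.val = n - 1) (haf : (a f).val = n - 2)
    (hal : (a l).val = 1) {u : Perm (Fin n)} (hu : u ∈ WJmin n) (huf : (u f).val ≤ n - 2)
    (hul : 1 ≤ (u l).val) : BruhatLE u a := by
  induction hm : (n - 2 - (u f).val) + ((u l).val - 1) using Nat.strong_induction_on
    generalizing u with
  | _ m ih =>
    subst hm
    have hfl : f ≠ l := by grind
    have hne : u f ≠ u l := fun h => hfl (u.injective h)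
    have step : ∀ v v' : Fin n, v < v' → (v = u f ∨ v' = u l) →
        (∀ x, v < x → x < v' → x = u f ∨ x = u l) →
        (swap v v' (u f)).val ≤ n - 2 → 1 ≤ (swap v v' (u l)).val →
        (n - 2 - (swap v v' (u f)).val) + ((swap v v' (u l)).val - 1) <
          (n - 2 - (u f).val) + ((u l).val - 1) → BruhatLE u a := by
      intro v v' hv hend hbtw h1 h2 hlt
      refine bruhatLE_of_swap_mul hv ?_
        (ih _ hlt (swap_mul_mem_WJmin hu hf hl hv hend hbtw) h1 h2 rfl)
      have hne' : u.symm v ≠ u.symm v' := fun h => hv.ne (u.symm.injective h)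
      rcases hend with rfl | rfl
      · rw [symm_apply_apply] at hne' ⊢
        grind
      · rw [symm_apply_apply] at hne' ⊢
        grind
    have hlt := (u l).isLt
    have hne' : (u f).val ≠ (u l).val := fun h => hne (Fin.ext h)
    simp only [swap_apply_def] at step
    by_cases hbot : (u f).val = 0 ∧ (u l).val = 1
    · have := step (u f) ⟨2, by omega⟩
      grind
    by_cases htop : (u f).val = n - 2 ∧ (u l).val = n - 1
    · have := step ⟨n - 3, by omega⟩ (u l)
      grind
    by_cases hp : (u f).val < n - 2
    · have := step (u f) ⟨(u f).val + 1, by omega⟩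
      grind
    by_cases hq : 1 < (u l).val
    · have := step ⟨(u l).val - 1, by omega⟩ (u l)
      grind
    have : u = a := WJmin_ext hu ha hf hl (Fin.ext (by omega)) (Fin.ext (by omega))
    subst this
    exact Relation.ReflTransGen.refl

/-- For `n ≥ 4`, let `w ∈ S_n` (1-indexed) have `w(1) = n-1`, `w(2) = n`,
`w(n-1) = 1`, `w(n) = 2` and `w(i) = n - i + 1` for `3 ≤ i ≤ n-2`, and let
`J = {2, …, n-2}`.  Then the rank sizes of `[e, w^J] ∩ W^J` in Bruhat order,
from rank `0` to rank `2n-5`, are `1, 2, …, n-4, n-3, n-2, n-1, n-3, n-4, …, 2, 1`. -/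
theorem stmt_5 (n : ℕ) (hn : 4 ≤ n) (w : Perm (Fin n))
    (hw1 : w ⟨0, by omega⟩ = ⟨n - 2, by omega⟩)
    (hw2 : w ⟨1, by omega⟩ = ⟨n - 1, by omega⟩)
    (hw3 : w ⟨n - 2, by omega⟩ = ⟨0, by omega⟩)
    (hw4 : w ⟨n - 1, by omega⟩ = ⟨1, by omega⟩)
    (hw5 : ∀ i : Fin n, 2 ≤ i.val → i.val ≤ n - 3 → (w i).val = n - 1 - i.val)
    -- the parabolic decomposition `w = w^J · w_J`
    (a b : Perm (Fin n)) (ha : a ∈ WJmin n) (hb : b ∈ WJsub n (by omega))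
    (hab : w = a * b)
    (k : ℕ) (hk : k ≤ 2 * n - 5) :
    Set.ncard {u : Perm (Fin n) | u ∈ WJmin n ∧ BruhatLE u a ∧ permLen u = k} =
      if k ≤ n - 4 then k + 1
      else if k = n - 3 then n - 2
      else if k = n - 2 then n - 1
      else 2 * n - 4 - k := by
  obtain ⟨f, hf⟩ : ∃ f : Fin n, f.val = 0 := ⟨⟨0, by omega⟩, rfl⟩
  obtain ⟨l, hl⟩ : ∃ l : Fin n, l.val = n - 1 := ⟨⟨n - 1, by omega⟩, rfl⟩
  have hfl : f ≠ l := by grind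
  have haf : (a f).val = n - 2 := by
    have h := congrArg (fun g : Perm (Fin n) => g ⟨0, by omega⟩) hab
    simp only [Perm.mul_apply, hb.1, hw1] at h
    rw [show f = ⟨0, by omega⟩ from Fin.ext hf, ← h]
  have hal : (a l).val = 1 := by
    have h := congrArg (fun g : Perm (Fin n) => g ⟨n - 1, by omega⟩) hab
    simp only [Perm.mul_apply, hb.2, hw4] at h
    rw [show l = ⟨n - 1, by omega⟩ from Fin.ext hl, ← h]
  have hle : ∀ u ∈ WJmin n, BruhatLE u a ↔ (u f).val ≤ n - 2 ∧ 1 ≤ (u l).val := by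
    intro u hu
    constructor
    · intro h
      have := h.first_le_and_last_le (f := f) (l := l) (by grind) (by grind)
      rw [Fin.le_def, Fin.le_def] at this
      omega
    · exact fun h => bruhatLE_of_mem_WJmin hn ha hf hl haf hal hu h.1 h.2
  have hset : {u : Perm (Fin n) | u ∈ WJmin n ∧ BruhatLE u a ∧ permLen u = k} =
      {u | u ∈ WJmin n ∧ ((u f).val ≤ n - 2 ∧ 1 ≤ (u l).val) ∧ permLen u = k} := by
    ext u
    exact and_congr_right fun hu => by rw [hle u hu]
  have hinj : Set.InjOn (fun u : Perm (Fin n) => (u f).val)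
      {u | u ∈ WJmin n ∧ ((u f).val ≤ n - 2 ∧ 1 ≤ (u l).val) ∧ permLen u = k} := by
    rintro u ⟨hu, -, hku⟩ v ⟨hv, -, hkv⟩ h
    have h : (u f).val = (v f).val := h
    refine WJmin_ext hu hv hf hl (Fin.ext h) (Fin.ext ?_)
    have h1 := permLen_of_mem_WJmin hu hf hl hfl
    have h2 := permLen_of_mem_WJmin hv hf hl hfl
    have h3 : (u f).val ≠ (u l).val := fun h => hfl (u.injective (Fin.ext h))
    have h4 : (v f).val ≠ (v l).val := fun h => hfl (v.injective (Fin.ext h))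
    have := (u l).isLt
    have := (v l).isLt
    simp only [Fin.lt_def] at h1 h2
    split_ifs at h1 h2 <;> omega
  have himg : (fun u : Perm (Fin n) => (u f).val) ''
      {u | u ∈ WJmin n ∧ ((u f).val ≤ n - 2 ∧ 1 ≤ (u l).val) ∧ permLen u = k} =
      ↑(Finset.Icc (if k ≤ n - 2 then 0 else k + 3 - n) (min k (n - 2))) := by
    ext p
    simp only [Set.mem_image, Set.mem_ofPred_eq, Finset.coe_Icc, Set.mem_Icc]
    constructor
    · rintro ⟨u, ⟨hu, ⟨h1, h2⟩, h3⟩, rfl⟩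
      have h4 := permLen_of_mem_WJmin hu hf hl hfl
      have h5 : (u f).val ≠ (u l).val := fun h => hfl (u.injective (Fin.ext h))
      have := (u l).isLt
      simp only [Fin.lt_def] at h4
      split_ifs at h4 ⊢ <;> omega
    · rintro ⟨h1, h2⟩
      obtain ⟨q, hq⟩ : ∃ q : ℕ, q = if k ≤ n - 2 then p + (n - 1) - k else p + (n - 2) - k :=
        ⟨_, rfl⟩
      have hqn : q < n ∧ 1 ≤ q ∧ p ≠ q := by split_ifs at h1 hq <;> omega
      obtain ⟨u, hu, huf, hul⟩ := exists_mem_WJmin (p := ⟨p, by omega⟩) (q := ⟨q, hqn.1⟩) hf hl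
        hfl (by simpa using hqn.2.2)
      have h4 := permLen_of_mem_WJmin hu hf hl hfl
      simp only [huf, hul, Fin.mk_lt_mk] at h4
      refine ⟨u, ⟨hu, ⟨?_, ?_⟩, ?_⟩, ?_⟩
      · rw [huf]; dsimp only; omega
      · rw [hul]; exact hqn.2.1
      · split_ifs at h1 hq h4 <;> omega
      · rw [huf]
  rw [hset, ← hinj.ncard_image, himg, Set.ncard_coe_finset, Nat.card_Icc]
  split_ifs <;> omega
end

section
/- Let w ∈ 𝔇_n be a signed permutation of type D with w(n) = −n. Then w ≥ u in Bruhat order for every u ∈ 𝔇_n of Coxeter length 2. -/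
open Equiv

/-- The simple reflections of type `D`, as permutations of `ℤ` (acting on
`±1, ±2, …`): `s_0 = (1,-2)(-1,2)` and `s_i = (i, i+1)(-i, -(i+1))` for `i ≥ 1`. -/
def dGen (i : ℕ) : Perm ℤ :=
  if i = 0 then Equiv.swap 1 (-2) * Equiv.swap (-1) 2
  else Equiv.swap (i : ℤ) ((i : ℤ) + 1) * Equiv.swap (-(i : ℤ)) (-(i : ℤ) - 1)

/-- The simple reflections `s_0, s_1, …, s_{n-1}` of `W(D_n)`. -/
def dGens (n : ℕ) : Set (Perm ℤ) := {g | ∃ i < n, g = dGen i}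

/-- The Weyl group `𝔇_n` of type `D_n`, realized as the group of (even) signed
permutations generated by the simple reflections. -/
def dGroup (n : ℕ) : Subgroup (Perm ℤ) := Subgroup.closure (dGens n)

/-- Coxeter length in `𝔇_n`: minimal length of a word in the simple reflections. -/
noncomputable def dLen (n : ℕ) (w : Perm ℤ) : ℕ :=
  sInf {k | ∃ l : List (Perm ℤ), (∀ g ∈ l, g ∈ dGens n) ∧ l.prod = w ∧ l.length = k}

/-- Reflections of `𝔇_n`: conjugates of the simple reflections. -/
def dReflections (n : ℕ) : Set (Perm ℤ) :=
  {t | ∃ g ∈ dGroup n, ∃ s ∈ dGens n, t = g * s * g⁻¹}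

/-- Bruhat order on `𝔇_n`. -/
def dBruhatLE (n : ℕ) (u v : Perm ℤ) : Prop :=
  Relation.ReflTransGen
    (fun x y => dLen n x < dLen n y ∧ ∃ t ∈ dReflections n, y = x * t) u v

/-- Smaller endpoint of the transposition defining `dGen i`. -/
def dLo (i : ℕ) : ℤ := if i = 0 then -2 else i

/-- Larger endpoint of the transposition defining `dGen i`. -/
def dHi (i : ℕ) : ℤ := if i = 0 then 1 else i + 1

lemma dGen_apply (i : ℕ) (x : ℤ) :
    dGen i x = if x = dLo i then dHi i else if x = dHi i then dLo i
      else if x = -dLo i then -dHi i else if x = -dHi i then -dLo i else x := by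
  unfold dGen dLo dHi
  by_cases hi : i = 0
  · simp only [hi, if_true, Perm.mul_apply, swap_apply_def]
    grind
  · simp only [hi, if_false, Perm.mul_apply, swap_apply_def]
    split_ifs <;> omega

lemma dGen_apply_apply (i : ℕ) (x : ℤ) : dGen i (dGen i x) = x := by
  have h := dGen_apply i
  have h1 := h x
  have h2 := h (dGen i x)
  unfold dLo dHi at h1 h2
  split_ifs at h1 h2 <;> omega

lemma dGen_mul_self (i : ℕ) : dGen i * dGen i = 1 := by
  ext x
  exact dGen_apply_apply i x

lemma dGen_inv (i : ℕ) : (dGen i)⁻¹ = dGen i :=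
  inv_eq_of_mul_eq_one_left (dGen_mul_self i)

lemma dGen_lo (i : ℕ) : dGen i (dLo i) = dHi i := by
  simp [dGen_apply]

lemma dGen_hi (i : ℕ) : dGen i (dHi i) = dLo i := by
  rw [← dGen_lo, dGen_apply_apply]

lemma dGen_neg (i : ℕ) (x : ℤ) : dGen i (-x) = -dGen i x := by
  simp only [dGen_apply]
  unfold dLo dHi
  split_ifs <;> omega

lemma dGen_of_lt {i : ℕ} {x : ℤ} (h : (i : ℤ) + 1 < |x|) (h2 : 2 < |x|) : dGen i x = x := by
  simp only [dGen_apply]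
  unfold dLo dHi
  split_ifs <;> grind

lemma abs_dGen_le {n i : ℕ} (hn : 2 ≤ n) (hi : i < n) {x : ℤ} (h : |x| ≤ n) :
    |dGen i x| ≤ n := by
  rw [abs_le] at *
  simp only [dGen_apply]
  unfold dLo dHi
  split_ifs <;> omega

lemma dGen_lt_dGen (i : ℕ) {a b : ℤ} (ha : a ≠ 0) (hb : b ≠ 0) (hab : a ≠ -b) (h : a < b) :
    dGen i a < dGen i b ∨ (a = dLo i ∧ b = dHi i) ∨ (a = -dHi i ∧ b = -dLo i) := by
  simp only [dGen_apply]
  unfold dLo dHi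
  split_ifs <;> omega

lemma dGen_mem {n i : ℕ} (hi : i < n) : dGen i ∈ dGroup n :=
  Subgroup.subset_closure ⟨i, hi, rfl⟩

lemma dGroup_induction {n : ℕ} {p : Perm ℤ → Prop} (one : p 1)
    (mul : ∀ x ∈ dGroup n, ∀ i < n, p x → p (x * dGen i)) {w : Perm ℤ}
    (hw : w ∈ dGroup n) : p w := by
  induction hw using Subgroup.closure_induction_right with
  | one => exact one
  | mul_right x hx y hy ih =>
    obtain ⟨i, hi, rfl⟩ := hy
    exact mul x hx i hi ih
  | mul_inv_cancel x hx y hy ih =>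
    obtain ⟨i, hi, rfl⟩ := hy
    rw [dGen_inv]
    exact mul x hx i hi ih

lemma map_neg_of_mem {n : ℕ} {w : Perm ℤ} (hw : w ∈ dGroup n) (x : ℤ) : w (-x) = -w x := by
  refine dGroup_induction (p := fun w => ∀ x, w (-x) = -w x) (by simp) ?_ hw x
  intro w _ i _ ih x
  simp [dGen_neg, ih]

lemma map_zero_of_mem {n : ℕ} {w : Perm ℤ} (hw : w ∈ dGroup n) : w 0 = 0 := by
  have := map_neg_of_mem hw 0
  simp only [neg_zero] at this
  omega

lemma map_ne_zero_of_mem {n : ℕ} {w : Perm ℤ} (hw : w ∈ dGroup n) {x : ℤ} (hx : x ≠ 0) :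
    w x ≠ 0 := by
  rw [← map_zero_of_mem hw]
  exact w.injective.ne hx

lemma abs_map_le_of_mem {n : ℕ} (hn : 2 ≤ n) {w : Perm ℤ} (hw : w ∈ dGroup n) {x : ℤ}
    (hx : |x| ≤ n) : |w x| ≤ n := by
  refine dGroup_induction (p := fun w => ∀ x : ℤ, |x| ≤ n → |w x| ≤ n) (by simp) ?_ hw x hx
  intro w _ i hi ih x hx
  exact ih _ (abs_dGen_le hn hi hx)

lemma map_of_lt_abs_of_mem {n : ℕ} (hn : 2 ≤ n) {w : Perm ℤ} (hw : w ∈ dGroup n) {x : ℤ}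
    (hx : n < |x|) : w x = x := by
  refine dGroup_induction (p := fun w => w x = x) (by simp) ?_ hw
  intro w _ i hi ih
  rw [Perm.mul_apply, dGen_of_lt (by omega) (by omega), ih]

lemma prod_map_of_mem {n : ℕ} (hn : 2 ≤ n) {w : Perm ℤ} (hw : w ∈ dGroup n) :
    ∏ k ∈ Finset.Icc (1 : ℤ) n, w k = ∏ k ∈ Finset.Icc (1 : ℤ) n, k := by
  refine dGroup_induction (p := fun w => ∏ k ∈ Finset.Icc (1 : ℤ) n, w k =
    ∏ k ∈ Finset.Icc (1 : ℤ) n, k) (by simp) ?_ hw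
  intro w hw i hi ih
  rw [← ih]
  have hneg := map_neg_of_mem hw
  obtain rfl | hi0 := Nat.eq_zero_or_pos i
  · have hsub : ({1, 2} : Finset ℤ) ⊆ Finset.Icc (1 : ℤ) n := by
      intro k hk
      simp only [Finset.mem_insert, Finset.mem_singleton] at hk
      simp only [Finset.mem_Icc]
      omega
    rw [← Finset.prod_sdiff hsub, ← Finset.prod_sdiff hsub]
    congr 1
    · refine Finset.prod_congr rfl fun k hk => ?_
      simp only [Finset.mem_sdiff, Finset.mem_Icc, Finset.mem_insert, Finset.mem_singleton] at hk
      rw [Perm.mul_apply, dGen_of_lt] <;> grind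
    · rw [Finset.prod_pair (by norm_num), Finset.prod_pair (by norm_num)]
      have h1 : dGen 0 1 = -2 := by simp [dGen_apply, dLo, dHi]
      have h2 : dGen 0 2 = -1 := by simp [dGen_apply, dLo, dHi]
      simp only [Perm.mul_apply, h1, h2, hneg]
      ring
  · refine Finset.prod_equiv (dGen i) (fun k => ?_) (fun k _ => rfl)
    simp only [Finset.mem_Icc, dGen_apply]
    unfold dLo dHi
    split_ifs <;> omega

lemma eq_of_eqOn_Icc {n : ℕ} (hn : 2 ≤ n) {w v : Perm ℤ} (hw : w ∈ dGroup n)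
    (hv : v ∈ dGroup n) (h : ∀ k : ℤ, 1 ≤ k → k ≤ n → w k = v k) : w = v := by
  ext x
  by_cases hx : |x| ≤ n
  · rw [abs_le] at hx
    obtain h0 | rfl | h0 := lt_trichotomy x 0
    · have := h (-x) (by omega) (by omega)
      rw [map_neg_of_mem hw, map_neg_of_mem hv] at this
      omega
    · rw [map_zero_of_mem hw, map_zero_of_mem hv]
    · exact h x (by omega) (by omega)
  · rw [map_of_lt_abs_of_mem hn hw (by omega), map_of_lt_abs_of_mem hn hv (by omega)]

/-- The pairs `a < b` in `{±1, …, ±n}` with `a ≠ -b` whose order is reversed by `w`. -/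
noncomputable def dInv (n : ℕ) (w : Perm ℤ) : Finset (ℤ × ℤ) :=
  (Finset.Icc (-(n : ℤ)) n ×ˢ Finset.Icc (-(n : ℤ)) n).filter
    fun p => p.1 ≠ 0 ∧ p.2 ≠ 0 ∧ p.1 ≠ -p.2 ∧ p.1 < p.2 ∧ w p.2 < w p.1

lemma mem_dInv {n : ℕ} {w : Perm ℤ} {a b : ℤ} : (a, b) ∈ dInv n w ↔
    (|a| ≤ n ∧ |b| ≤ n) ∧ a ≠ 0 ∧ b ≠ 0 ∧ a ≠ -b ∧ a < b ∧ w b < w a := by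
  simp [dInv, abs_le]

lemma dLo_lt_dHi (i : ℕ) : dLo i < dHi i := by
  unfold dLo dHi
  split_ifs <;> omega

lemma card_dInv_mul_dGen {n : ℕ} (hn : 2 ≤ n) {w : Perm ℤ} (hw : w ∈ dGroup n) {i : ℕ}
    (hi : i < n) (h : w (dLo i) < w (dHi i)) :
    (dInv n (w * dGen i)).card = (dInv n w).card + 2 := by
  have hneg := map_neg_of_mem hw
  have hlt := dLo_lt_dHi i
  have hlo : |dLo i| ≤ n := by
    rw [abs_le]; unfold dLo; split_ifs <;> omega
  have hhi : |dHi i| ≤ n := by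
    rw [abs_le]; unfold dHi; split_ifs <;> omega
  have hlo0 : dLo i ≠ 0 := by
    unfold dLo; split_ifs <;> omega
  have hhi0 : dHi i ≠ 0 := by
    unfold dHi; split_ifs <;> omega
  have hlohi : dLo i ≠ -dHi i := by
    unfold dLo dHi; split_ifs <;> omega
  have hcard : (dInv n w ∪ {(dHi i, dLo i), (-dLo i, -dHi i)}).card = (dInv n w).card + 2 := by
    rw [Finset.card_union_of_disjoint, Finset.card_pair]
    · simp only [ne_eq, Prod.mk.injEq]
      omega
    · simp only [Finset.disjoint_insert_right, Finset.disjoint_singleton_right, mem_dInv]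
      omega
  have hne : ∀ {x : ℤ}, x ≠ 0 → dGen i x ≠ 0 := map_ne_zero_of_mem (dGen_mem hi)
  have hne' : ∀ {x y : ℤ}, x ≠ -y → dGen i x ≠ -dGen i y := by
    intro x y hxy
    rw [← dGen_neg]
    exact (dGen i).injective.ne hxy
  rw [← hcard]
  refine Finset.card_nbij' (Prod.map (dGen i) (dGen i)) (Prod.map (dGen i) (dGen i)) ?_ ?_ ?_ ?_
  · rintro ⟨a, b⟩ hab
    simp only [Finset.mem_coe, mem_dInv, Perm.mul_apply] at hab
    obtain ⟨⟨han, hbn⟩, ha, hb, hab, hl, hinv⟩ := hab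
    simp only [Finset.coe_union, Set.mem_union, Finset.mem_coe, Prod.map_apply, mem_dInv,
      Finset.mem_insert, Finset.mem_singleton, Prod.mk.injEq]
    rcases dGen_lt_dGen i ha hb hab hl with h' | ⟨rfl, rfl⟩ | ⟨rfl, rfl⟩
    · exact Or.inl ⟨⟨abs_dGen_le hn hi han, abs_dGen_le hn hi hbn⟩, hne ha, hne hb, hne' hab,
        h', hinv⟩
    · simp [dGen_lo, dGen_hi]
    · simp [dGen_neg, dGen_lo, dGen_hi]
  · rintro ⟨a, b⟩ hab
    simp only [Finset.coe_union, Set.mem_union, Finset.mem_coe, mem_dInv,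
      Finset.mem_insert, Finset.mem_singleton, Prod.mk.injEq] at hab
    simp only [Finset.mem_coe, Prod.map_apply, mem_dInv, Perm.mul_apply, dGen_apply_apply]
    rcases hab with ⟨⟨han, hbn⟩, ha, hb, hab, hl, hinv⟩ | ⟨rfl, rfl⟩ | ⟨rfl, rfl⟩
    · refine ⟨⟨abs_dGen_le hn hi han, abs_dGen_le hn hi hbn⟩, hne ha, hne hb, hne' hab, ?_, hinv⟩
      rcases dGen_lt_dGen i ha hb hab hl with h' | ⟨rfl, rfl⟩ | ⟨rfl, rfl⟩
      · exact h'
      · omega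
      · rw [hneg, hneg] at hinv
        omega
    · rw [dGen_lo, dGen_hi]
      exact ⟨⟨hlo, hhi⟩, hlo0, hhi0, hlohi, hlt, h⟩
    · rw [dGen_neg, dGen_neg, dGen_lo, dGen_hi, hneg, hneg, abs_neg, abs_neg]
      refine ⟨⟨hhi, hlo⟩, ?_, ?_, ?_, ?_, ?_⟩ <;> omega
  · rintro ⟨a, b⟩ _
    simp [dGen_apply_apply]
  · rintro ⟨a, b⟩ _
    simp [dGen_apply_apply]

lemma card_dInv_mul_dGen_of_gt {n : ℕ} (hn : 2 ≤ n) {w : Perm ℤ} (hw : w ∈ dGroup n) {i : ℕ}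
    (hi : i < n) (h : w (dHi i) < w (dLo i)) :
    (dInv n w).card = (dInv n (w * dGen i)).card + 2 := by
  rw [← card_dInv_mul_dGen hn (mul_mem hw (dGen_mem hi)) hi, mul_assoc, dGen_mul_self, mul_one]
  simpa [dGen_lo, dGen_hi] using h

lemma map_eq_self_of_ascents {n m : ℕ} (hm : 2 ≤ m) {w : Perm ℤ} (hw : w ∈ dGroup n)
    (hb : w m ≤ m)
    (h : ∀ i < m, w (dLo i) < w (dHi i)) {k : ℤ} (hk : 2 ≤ k) (hkm : k ≤ m) : w k = k := by
  have hneg := map_neg_of_mem hw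
  have hstep : ∀ i : ℕ, 1 ≤ i → i < m → w i < w (i + 1) := by
    intro i h1 h2
    have hi : i ≠ 0 := by omega
    simpa [dLo, dHi, hi] using h i h2
  have h1 := map_ne_zero_of_mem hw one_ne_zero
  have h2 : 2 ≤ w 2 := by
    have h0 := h 0 (by omega)
    have h1 := hstep 1 le_rfl (by omega)
    simp only [dLo, dHi, if_true, hneg] at h0
    norm_num at h1
    omega
  have hlow : ∀ j : ℕ, 2 ≤ j → j ≤ m → (j : ℤ) ≤ w j := by
    intro j hj
    induction j, hj using Nat.le_induction with
    | base => intro; exact_mod_cast h2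
    | succ j hj ih =>
      intro hjm
      have := hstep j (by omega) (by omega)
      have := ih (by omega)
      push_cast
      omega
  have hup : ∀ d j : ℕ, 2 ≤ j → j + d = m → w j ≤ j := by
    intro d
    induction d with
    | zero => rintro j _ rfl; exact hb
    | succ d ih =>
      intro j hj hjd
      have h1 := hstep j (by omega) (by omega)
      have h2 := ih (j + 1) (by omega) (by omega)
      push_cast at h2
      omega
  lift k to ℕ using by omega
  exact le_antisymm (hup (m - k) k (by omega) (by omega)) (hlow k (by omega) (by omega))

lemma eq_one_of_ascents {n : ℕ} (hn : 2 ≤ n) {w : Perm ℤ} (hw : w ∈ dGroup n)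
    (h : ∀ i < n, w (dLo i) < w (dHi i)) : w = 1 := by
  have hb : w n ≤ n := (abs_le.mp (abs_map_le_of_mem hn hw (x := n) (by simp))).2
  have hfix : ∀ k : ℤ, 2 ≤ k → k ≤ n → w k = k :=
    fun k h1 h2 => map_eq_self_of_ascents hn hw hb h h1 h2
  refine eq_of_eqOn_Icc hn hw (one_mem _) fun k h1 h2 => ?_
  obtain rfl | h1 := h1.eq_or_lt
  · have hp := prod_map_of_mem hn hw
    have hins : Finset.Icc (1 : ℤ) n = insert 1 (Finset.Icc 2 (n : ℤ)) := by
      ext k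
      simp only [Finset.mem_Icc, Finset.mem_insert]
      omega
    rw [hins, Finset.prod_insert (by simp), Finset.prod_insert (by simp),
      Finset.prod_congr rfl fun k hk => hfix k (Finset.mem_Icc.mp hk).1 (Finset.mem_Icc.mp hk).2]
      at hp
    refine mul_right_cancel₀ (Finset.prod_ne_zero_iff.mpr fun k hk => ?_) hp
    have := (Finset.mem_Icc.mp hk).1
    omega
  · exact hfix k (by omega) h2

/-- The element of `𝔇_n` spelled by a list of indices of simple reflections. -/
def dWord (l : List ℕ) : Perm ℤ := (l.map dGen).prod

lemma dWord_append (l m : List ℕ) : dWord (l ++ m) = dWord l * dWord m := by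
  simp [dWord]

lemma dWord_cons (i : ℕ) (l : List ℕ) : dWord (i :: l) = dGen i * dWord l := by
  simp [dWord]

lemma dWord_singleton (i : ℕ) : dWord [i] = dGen i := by
  simp [dWord]

lemma dWord_mem {n : ℕ} {l : List ℕ} (hl : ∀ i ∈ l, i < n) : dWord l ∈ dGroup n := by
  refine list_prod_mem fun g hg => ?_
  obtain ⟨i, hi, rfl⟩ := List.mem_map.mp hg
  exact dGen_mem (hl i hi)

lemma dWord_inv (l : List ℕ) : (dWord l)⁻¹ = dWord l.reverse := by
  simp [dWord, List.prod_inv_reverse, Function.comp_def, dGen_inv]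

lemma dLen_eq_sInf (n : ℕ) (w : Perm ℤ) :
    dLen n w = sInf {k | ∃ l : List ℕ, (∀ i ∈ l, i < n) ∧ dWord l = w ∧ l.length = k} := by
  unfold dLen
  congr 1
  ext k
  constructor
  · rintro ⟨l, hl, rfl, rfl⟩
    have : ∃ m : List ℕ, (∀ i ∈ m, i < n) ∧ m.map dGen = l := by
      induction l with
      | nil => exact ⟨[], by simp⟩
      | cons g l ih =>
        obtain ⟨m, hm, rfl⟩ := ih fun g hg => hl g (List.mem_cons_of_mem _ hg)
        obtain ⟨i, hi, rfl⟩ := hl g List.mem_cons_self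
        exact ⟨i :: m, by simpa using ⟨hi, hm⟩, rfl⟩
    obtain ⟨m, hm, rfl⟩ := this
    exact ⟨m, hm, rfl, by simp⟩
  · rintro ⟨l, hl, rfl, rfl⟩
    refine ⟨l.map dGen, fun g hg => ?_, rfl, by simp⟩
    obtain ⟨i, hi, rfl⟩ := List.mem_map.mp hg
    exact ⟨i, hl i hi, rfl⟩

lemma dLen_dWord_le {n : ℕ} {l : List ℕ} (hl : ∀ i ∈ l, i < n) : dLen n (dWord l) ≤ l.length := by
  rw [dLen_eq_sInf]
  exact Nat.sInf_le ⟨l, hl, rfl, rfl⟩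

lemma exists_descent_of_ne_one {n : ℕ} (hn : 2 ≤ n) {w : Perm ℤ} (hw : w ∈ dGroup n)
    (h1 : w ≠ 1) : ∃ i < n, w (dHi i) < w (dLo i) := by
  by_contra! h
  refine h1 (eq_one_of_ascents hn hw fun i hi => lt_of_le_of_ne (h i hi) ?_)
  exact w.injective.ne (dLo_lt_dHi i).ne

lemma exists_dWord {n : ℕ} (hn : 2 ≤ n) {w : Perm ℤ} (hw : w ∈ dGroup n) :
    ∃ l : List ℕ, (∀ i ∈ l, i < n) ∧ dWord l = w ∧ 2 * l.length = (dInv n w).card := by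
  induction hk : (dInv n w).card using Nat.strong_induction_on generalizing w with
  | _ k ih =>
    by_cases h1 : w = 1
    · subst h1
      refine ⟨[], by simp, by simp [dWord], ?_⟩
      rw [← hk, eq_comm, List.length_nil, mul_zero, Finset.card_eq_zero,
        Finset.eq_empty_iff_forall_notMem]
      rintro ⟨a, b⟩ h
      rw [mem_dInv, Perm.one_apply, Perm.one_apply] at h
      omega
    · obtain ⟨i, hi, hd⟩ := exists_descent_of_ne_one hn hw h1
      have hc := card_dInv_mul_dGen_of_gt hn hw hi hd
      obtain ⟨l, hl, hlw, hlen⟩ := ih _ (by omega) (mul_mem hw (dGen_mem hi)) rfl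
      refine ⟨l ++ [i], ?_, ?_, ?_⟩
      · simpa [or_imp, forall_and] using ⟨hl, hi⟩
      · rw [dWord_append, hlw, dWord_singleton, mul_assoc, dGen_mul_self, mul_one]
      · rw [List.length_append, List.length_singleton]
        omega

lemma card_dInv_dWord_le {n : ℕ} (hn : 2 ≤ n) {l : List ℕ} (hl : ∀ i ∈ l, i < n) :
    (dInv n (dWord l)).card ≤ 2 * l.length := by
  induction l using List.reverseRecOn with
  | nil =>
    rw [List.length_nil, mul_zero, Nat.le_zero, Finset.card_eq_zero,
      Finset.eq_empty_iff_forall_notMem]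
    rintro ⟨a, b⟩ h
    rw [mem_dInv] at h
    simp only [dWord, List.map_nil, List.prod_nil, Perm.one_apply] at h
    omega
  | append_singleton l i ih =>
    have hl' : ∀ j ∈ l, j < n := fun j hj => hl j (by simp [hj])
    have hi : i < n := hl i (by simp)
    have hw := dWord_mem hl'
    have := ih hl'
    rw [dWord_append, dWord_singleton, List.length_append, List.length_singleton]
    rcases lt_or_gt_of_ne ((dWord l).injective.ne (dLo_lt_dHi i).ne) with h | h
    · rw [card_dInv_mul_dGen hn hw hi h]
      omega
    · have := card_dInv_mul_dGen_of_gt hn hw hi h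
      omega

lemma two_mul_dLen {n : ℕ} (hn : 2 ≤ n) {w : Perm ℤ} (hw : w ∈ dGroup n) :
    2 * dLen n w = (dInv n w).card := by
  obtain ⟨l, hl, hlw, hlen⟩ := exists_dWord hn hw
  apply le_antisymm
  · have := dLen_dWord_le hl
    rw [hlw] at this
    omega
  · have hmem := Nat.sInf_mem (s := {k | ∃ l : List ℕ, (∀ i ∈ l, i < n) ∧ dWord l = w ∧
      l.length = k}) ⟨_, l, hl, hlw, rfl⟩
    rw [← dLen_eq_sInf] at hmem
    obtain ⟨m, hm, hmw, hmk⟩ := hmem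
    rw [← hmk, ← hmw]
    exact card_dInv_dWord_le hn hm

lemma dLen_mul_dGen {n : ℕ} (hn : 2 ≤ n) {w : Perm ℤ} (hw : w ∈ dGroup n) {i : ℕ} (hi : i < n)
    (h : w (dLo i) < w (dHi i)) : dLen n (w * dGen i) = dLen n w + 1 := by
  have h1 := two_mul_dLen hn hw
  have h2 := two_mul_dLen hn (mul_mem hw (dGen_mem hi))
  rw [card_dInv_mul_dGen hn hw hi h] at h2
  omega

lemma dLen_mul_dGen_lt {n : ℕ} (hn : 2 ≤ n) {w : Perm ℤ} (hw : w ∈ dGroup n) {i : ℕ}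
    (hi : i < n) (h : w (dHi i) < w (dLo i)) : dLen n (w * dGen i) < dLen n w := by
  have h1 := two_mul_dLen hn hw
  have h2 := two_mul_dLen hn (mul_mem hw (dGen_mem hi))
  rw [card_dInv_mul_dGen_of_gt hn hw hi h] at h1
  omega

lemma dLen_inv (n : ℕ) (w : Perm ℤ) : dLen n w⁻¹ = dLen n w := by
  rw [dLen_eq_sInf, dLen_eq_sInf]
  congr 1
  ext k
  constructor
  · rintro ⟨l, hl, hw, rfl⟩
    exact ⟨l.reverse, by simpa using hl, by rw [← dWord_inv, hw, inv_inv], by simp⟩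
  · rintro ⟨l, hl, rfl, rfl⟩
    exact ⟨l.reverse, by simpa using hl, (dWord_inv l).symm, by simp⟩

lemma dReflections_subset {n : ℕ} {t : Perm ℤ} (ht : t ∈ dReflections n) : t ∈ dGroup n := by
  obtain ⟨g, hg, s, hs, rfl⟩ := ht
  exact mul_mem (mul_mem hg (Subgroup.subset_closure hs)) (inv_mem hg)

lemma conj_mem_dReflections {n : ℕ} {t x : Perm ℤ} (ht : t ∈ dReflections n)
    (hx : x ∈ dGroup n) : x * t⁻¹ * x⁻¹ ∈ dReflections n := by
  obtain ⟨g, hg, s, ⟨i, hi, rfl⟩, rfl⟩ := ht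
  refine ⟨x * g, mul_mem hx hg, _, ⟨i, hi, rfl⟩, ?_⟩
  simp [mul_assoc, dGen_inv]

lemma dGen_mem_dReflections {n i : ℕ} (hi : i < n) : dGen i ∈ dReflections n :=
  ⟨1, one_mem _, _, ⟨i, hi, rfl⟩, by simp⟩

lemma dBruhatLE.inv {n : ℕ} {u v : Perm ℤ} (hu : u ∈ dGroup n) (h : dBruhatLE n u v) :
    dBruhatLE n u⁻¹ v⁻¹ := by
  suffices v ∈ dGroup n ∧ dBruhatLE n u⁻¹ v⁻¹ from this.2
  induction h with
  | refl => exact ⟨hu, .refl⟩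
  | tail _ h ih =>
    obtain ⟨hlt, t, ht, rfl⟩ := h
    refine ⟨mul_mem ih.1 (dReflections_subset ht), ih.2.tail ⟨?_, _,
      conj_mem_dReflections ht ih.1, by group⟩⟩
    rwa [dLen_inv, dLen_inv]

lemma dBruhatLE_of_mul_dGen {n : ℕ} (hn : 2 ≤ n) {u w : Perm ℤ} (hw : w ∈ dGroup n) {i : ℕ}
    (hi : i < n) (h : w (dHi i) < w (dLo i)) (hu : dBruhatLE n u (w * dGen i)) :
    dBruhatLE n u w := by
  refine hu.tail ⟨dLen_mul_dGen_lt hn hw hi h, _, dGen_mem_dReflections hi, ?_⟩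
  rw [mul_assoc, dGen_mul_self, mul_one]

lemma dWord_lo_lt_hi {i : ℕ} {l : List ℕ} (hl : l.Pairwise (· < ·)) (hi : ∀ j ∈ l, j < i) :
    dWord l (dLo i) < dWord l (dHi i) := by
  obtain h2 | h2 := lt_or_ge i 2
  · have h : l = [] ∨ (l = [0] ∧ i = 1) := by
      rcases l with _ | ⟨a, _ | ⟨b, l⟩⟩
      · simp
      · have := hi a (by simp)
        simp only [List.cons.injEq, and_true]
        omega
      · have := hi b (by simp)
        have := List.rel_of_pairwise_cons hl (a' := b) (by simp)
        omega
    obtain rfl | ⟨rfl, rfl⟩ := h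
    · exact dLo_lt_dHi i
    · rw [dWord_singleton, dGen_apply, dGen_apply]
      simp [dLo, dHi]
  · have hw := dWord_mem hi
    have h1 : (i : ℤ) < i + 1 := by omega
    have := (abs_le.mp (abs_map_le_of_mem h2 hw (x := i) (by simp))).2
    have h3 := map_of_lt_abs_of_mem h2 hw (x := i + 1) (by rw [abs_of_nonneg] <;> omega)
    have hi0 : i ≠ 0 := by omega
    simp only [dLo, dHi, hi0, if_false, h3]
    omega

lemma dLen_dWord_of_pairwise {n : ℕ} (hn : 2 ≤ n) {l : List ℕ} (hl : l.Pairwise (· < ·))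
    (hln : ∀ j ∈ l, j < n) : dLen n (dWord l) = l.length := by
  induction l using List.reverseRecOn with
  | nil => exact Nat.le_zero.mp (dLen_dWord_le (by simp))
  | append_singleton l i ih =>
    have hl' : ∀ j ∈ l, j < n := fun j hj => hln j (by simp [hj])
    rw [List.pairwise_append] at hl
    rw [dWord_append, dWord_singleton, dLen_mul_dGen hn (dWord_mem hl') (hln i (by simp))
      (dWord_lo_lt_hi hl.1 fun j hj => hl.2.2 j hj i (by simp)), ih hl.1 hl']
    simp

lemma dBruhatLE_of_sublist {n : ℕ} (hn : 2 ≤ n) {l l' : List ℕ} (h : l'.Sublist l) :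
    ∀ p : List ℕ, (p ++ l).Pairwise (· < ·) → (∀ j ∈ p ++ l, j < n) →
      dBruhatLE n (dWord (p ++ l')) (dWord (p ++ l)) := by
  induction h with
  | slnil => exact fun p _ _ => .refl
  | @cons l' l a h ih =>
    intro p hp hn'
    have hsub : (p ++ l).Sublist (p ++ a :: l) :=
      (List.Sublist.refl p).append (List.sublist_cons_self a l)
    have hp1 := hp.sublist hsub
    have hn1 : ∀ j ∈ p ++ l, j < n := fun j hj => hn' j (hsub.subset hj)
    refine (ih p hp1 hn1).tail ⟨?_, (dWord l)⁻¹ * dGen a * (dWord l)⁻¹⁻¹,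
      ⟨_, inv_mem (dWord_mem fun j hj => hn1 j (by simp [hj])), _,
        ⟨a, hn' a (by simp), rfl⟩, rfl⟩, ?_⟩
    · rw [dLen_dWord_of_pairwise hn hp1 hn1, dLen_dWord_of_pairwise hn hp hn']
      simp
    · rw [dWord_append, dWord_append, dWord_cons]
      group
  | @cons_cons l' l a h ih =>
    intro p hp hn'
    have := ih (p ++ [a]) (by simpa using hp) (by simpa using hn')
    simpa using this

lemma dWord_range_apply {m : ℕ} (hm : 2 ≤ m) : dWord (List.range m) 1 = -1 ∧
    dWord (List.range m) m = -2 ∧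
    ∀ k : ℤ, 2 ≤ k → k < m → dWord (List.range m) k = k + 1 := by
  induction m, hm using Nat.le_induction with
  | base =>
    refine ⟨?_, ?_, by omega⟩ <;>
    simp [dWord, List.range_succ, dGen_apply, dLo, dHi]
  | succ m hm ih =>
    obtain ⟨h1, h2, h3⟩ := ih
    have hfix : dWord (List.range m) (m + 1) = m + 1 :=
      map_of_lt_abs_of_mem hm (dWord_mem fun j hj => List.mem_range.mp hj)
        (by rw [abs_of_nonneg] <;> omega)
    have hm0 : m ≠ 0 := by omega
    have hlo : dLo m = m := by simp [dLo, hm0]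
    have hhi : dHi m = m + 1 := by simp [dHi, hm0]
    have hs : ∀ k : ℤ, 1 ≤ k → k < m → dGen m k = k := by
      intro k hk hkm
      rw [dGen_apply, hlo, hhi]
      split_ifs <;> omega
    simp only [List.range_succ, dWord_append, dWord_singleton, Perm.mul_apply]
    push_cast
    refine ⟨by rw [hs 1 le_rfl (by omega), h1], by rw [← hhi, dGen_hi, hlo, h2], ?_⟩
    intro k hk hkm
    obtain rfl | hlt := (Int.lt_add_one_iff.mp hkm).eq_or_lt
    · conv_lhs => rw [← hlo, dGen_lo, hhi]
      exact hfix
    · rw [hs k (by omega) hlt, h3 k hk hlt]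

lemma dBruhatLE_of_map_eq_neg {n m : ℕ} (hm : 2 ≤ m) (hmn : m ≤ n) {w : Perm ℤ}
    (hw : w ∈ dGroup n) (h1 : w 1 = -1) (hwm : w m = -n)
    (hlt : ∀ k : ℤ, 2 ≤ k → k < m → w k = k) (hgt : ∀ k : ℤ, m < k → k ≤ n → w k = k - 1) :
    dBruhatLE n (dWord (List.range n))⁻¹ w := by
  have hn : 2 ≤ n := hm.trans hmn
  have hneg := map_neg_of_mem hw
  induction m, hm using Nat.le_induction generalizing w with
  | base =>
    have hc := dWord_mem (n := n) (l := List.range n) fun j hj => List.mem_range.mp hj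
    obtain ⟨c1, cn, ck⟩ := dWord_range_apply hn
    have : w * dWord (List.range n) = 1 := by
      refine eq_of_eqOn_Icc hn (mul_mem hw hc) (one_mem _) fun k hk hkn => ?_
      rw [Perm.mul_apply, Perm.one_apply]
      obtain rfl | hk := hk.eq_or_lt
      · rw [c1, hneg, h1, neg_neg]
      obtain rfl | hkn := hkn.eq_or_lt
      · rw [cn, hneg]
        push_cast at hwm
        rw [hwm, neg_neg]
      · rw [ck k (by omega) hkn, hgt _ (by push_cast; omega) (by omega)]
        omega
    rw [← eq_inv_of_mul_eq_one_left this]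
    exact .refl
  | succ m hm ih =>
    have hm0 : m ≠ 0 := by omega
    have hlo : dLo m = m := by simp [dLo, hm0]
    have hhi : dHi m = m + 1 := by simp [dHi, hm0]
    push_cast at hwm hlt hgt
    have hs : ∀ k : ℤ, 1 ≤ k → k ≠ m → k ≠ m + 1 → dGen m k = k := by
      intro k hk hkm hkm'
      rw [dGen_apply, hlo, hhi]
      split_ifs <;> omega
    have hwlo := hlt m (by omega) (by omega)
    have hw' := mul_mem hw (dGen_mem (n := n) (i := m) (by omega))
    refine dBruhatLE_of_mul_dGen hn hw (i := m) (by omega) ?_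
      (ih (by omega) hw' ?_ ?_ ?_ ?_ (map_neg_of_mem hw'))
    · rw [hlo, hhi, hwm, hwlo]
      omega
    · rw [Perm.mul_apply, hs 1 le_rfl (by omega) (by omega), h1]
    · rw [Perm.mul_apply, ← hlo, dGen_lo, hhi, hwm]
    · intro k hk hkm
      rw [Perm.mul_apply, hs k (by omega) (by omega) (by omega), hlt k hk (by omega)]
    · intro k hk hkn
      rw [Perm.mul_apply]
      by_cases hkm : k = m + 1
      · rw [hkm, ← hhi, dGen_hi, hlo, hwlo, hhi]
        omega
      · rw [hs k (by omega) (by omega) hkm, hgt k (by omega) hkn]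

lemma inv_dWord_range_le {n : ℕ} (hn : 2 ≤ n) {w : Perm ℤ} (hw : w ∈ dGroup n)
    (hwn : w n = -n) : dBruhatLE n (dWord (List.range n))⁻¹ w := by
  have hneg := map_neg_of_mem hw
  induction hk : dLen n w using Nat.strong_induction_on generalizing w with
  | _ k ih =>
    by_cases hd : ∃ i, i + 1 < n ∧ (i = 0 → 2 < n) ∧ w (dHi i) < w (dLo i)
    · obtain ⟨i, hi, hi0, hd⟩ := hd
      have hw' := mul_mem hw (dGen_mem (n := n) (i := i) (by omega))
      refine dBruhatLE_of_mul_dGen hn hw (i := i) (by omega) hd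
        (ih _ (hk ▸ dLen_mul_dGen_lt hn hw (by omega) hd) hw' ?_ (map_neg_of_mem hw') rfl)
      have : dGen i n = n :=
        dGen_of_lt (by rw [Nat.abs_cast]; omega) (by rw [Nat.abs_cast]; omega)
      rw [Perm.mul_apply, this, hwn]
    · push Not at hd
      have hlt : ∀ k : ℤ, 2 ≤ k → k < n → w k = k := by
        intro k hk2 hkn
        refine map_eq_self_of_ascents (m := n - 1) (by omega) hw ?_ ?_ hk2 (by omega)
        · have hle := (abs_le.mp (abs_map_le_of_mem hn hw (x := (n - 1 : ℕ))
            (abs_le.mpr (by omega)))).2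
          have hne : w (n - 1 : ℕ) ≠ w (-n) := w.injective.ne (by omega)
          rw [hneg, hwn] at hne
          omega
        · intro i hi
          exact lt_of_le_of_ne (hd i (by omega) fun _ => by omega)
            (w.injective.ne (dLo_lt_dHi i).ne)
      refine dBruhatLE_of_map_eq_neg hn le_rfl hw ?_ hwn hlt (by omega)
      have hp := prod_map_of_mem hn hw
      have hins : Finset.Icc (1 : ℤ) n = insert 1 (insert (n : ℤ) (Finset.Ico 2 (n : ℤ))) := by
        ext k
        simp only [Finset.mem_Icc, Finset.mem_insert, Finset.mem_Ico]
        omega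
      have hn1 : (1 : ℤ) ∉ insert (n : ℤ) (Finset.Ico 2 (n : ℤ)) := by
        simp only [Finset.mem_insert, Finset.mem_Ico]
        omega
      rw [hins, Finset.prod_insert hn1, Finset.prod_insert hn1, Finset.prod_insert (by simp),
        Finset.prod_insert (by simp), hwn, Finset.prod_congr rfl fun k hk =>
          hlt k (Finset.mem_Ico.mp hk).1 (Finset.mem_Ico.mp hk).2] at hp
      have hne : ∏ k ∈ Finset.Ico 2 (n : ℤ), k ≠ 0 := Finset.prod_ne_zero_iff.mpr fun k hk => by
        have := (Finset.mem_Ico.mp hk).1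
        omega
      have hn0 : (n : ℤ) ≠ 0 := by omega
      refine mul_right_cancel₀ (mul_ne_zero hn0 hne) ?_
      linear_combination -hp

lemma dGen_mul_dGen_le {n i j : ℕ} (hn : 2 ≤ n) (hij : i < j) (hj : j < n) :
    dBruhatLE n (dGen i * dGen j) (dWord (List.range n)) := by
  have hsub : [i, j].Sublist (List.range n) := by
    refine List.sublist_of_subperm_of_pairwise (r := (· < ·)) ?_ ?_ List.pairwise_lt_range
    · refine List.subperm_of_subset (by simp; omega) ?_
      intro k hk
      simp only [List.mem_cons, List.not_mem_nil, or_false] at hk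
      rw [List.mem_range]
      omega
    · simpa using hij
  simpa [dWord] using dBruhatLE_of_sublist hn hsub [] (by simpa using List.pairwise_lt_range)
    (by simp)

/-- Let `w ∈ 𝔇_n` be a signed permutation of type `D` with `w(n) = -n`.  Then
`w ≥ u` in Bruhat order for every `u ∈ 𝔇_n` of Coxeter length `2`. -/
theorem stmt_10 (n : ℕ) (hn : 2 ≤ n) (w : Perm ℤ) (hw : w ∈ dGroup n)
    (hwn : w (n : ℤ) = -(n : ℤ))
    (u : Perm ℤ) (hu : u ∈ dGroup n) (hlu : dLen n u = 2) :
    dBruhatLE n u w := by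
  have hc := dWord_mem (n := n) (l := List.range n) fun j hj => List.mem_range.mp hj
  have hw' : dBruhatLE n (dWord (List.range n)) w := by
    have hwn' : w⁻¹ n = -n := by
      rw [Perm.inv_eq_iff_eq, map_neg_of_mem hw, hwn, neg_neg]
    simpa using (inv_dWord_range_le hn (inv_mem hw) hwn').inv (inv_mem hc)
  obtain ⟨l, hl, rfl, hlen⟩ : ∃ l : List ℕ, (∀ i ∈ l, i < n) ∧ dWord l = u ∧ l.length = 2 := by
    rw [dLen_eq_sInf] at hlu
    have := Nat.sInf_mem (Nat.nonempty_of_sInf_eq_succ hlu)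
    rwa [hlu] at this
  obtain ⟨i, j, rfl⟩ := List.length_eq_two.mp hlen
  have hi : i < n := hl i (by simp)
  have hj : j < n := hl j (by simp)
  rw [dWord_cons, dWord_singleton] at hlu ⊢
  obtain hij | rfl | hij := lt_trichotomy i j
  · exact (dGen_mul_dGen_le hn hij hj).trans hw'
  · rw [dGen_mul_self] at hlu
    have := dLen_dWord_le (n := n) (l := []) (by simp)
    simp only [dWord, List.map_nil, List.prod_nil, List.length_nil] at this
    omega
  · have := (dGen_mul_dGen_le hn hij hi).inv (mul_mem (dGen_mem hj) (dGen_mem hi))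
    rw [mul_inv_rev, dGen_inv, dGen_inv] at this
    exact this.trans (inv_dWord_range_le hn hw hwn)
end
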